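/- For all nonnegative integers u and v and every number of items m ≥ 6u + 6v + 2, there is no deterministic truthful mechanism for two agents with additive valuations over m items that outputs an EF^{+u}_{-v} allocation on every valuation profile. -/

import Mathlib

open Finset

/-- `A` is an ordered partition of the item set `M` into `n` bundles. -/
def IsPartition {ι : Type*} [DecidableEq ι] {n : ℕ} (M : Finset ι)
    (A : Fin n → Finset ι) : Prop :=
  (∀ i, A i ⊆ M) ∧ (∀ i j, i ≠ j → Disjoint (A i) (A j)) ∧ (∀ g ∈ M, ∃ i, g ∈ A i)

/-- The allocation `A` of the items `M` is EF^{+u}_{-w} for the additive valuations `v`. -/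
def EFpm {ι : Type*} [DecidableEq ι] {n : ℕ} (M : Finset ι) (v : Fin n → ι → ℝ)
    (A : Fin n → Finset ι) (u w : ℕ) : Prop :=
  ∀ i j : Fin n, ∃ Si Sj : Finset ι,
    Si ⊆ M ∧ Disjoint Si (A i) ∧ Si.card ≤ u ∧
    Sj ⊆ A j ∧ Sj.card ≤ w ∧
    ∑ g ∈ A j \ Sj, v i g ≤ ∑ g ∈ A i ∪ Si, v i g

/-- A deterministic mechanism for two agents is truthful if no agent can strictly increase
her (true) utility by reporting an alternative nonnegative additive valuation. -/
def Truthful2 {m : ℕ} (Mech : (Fin 2 → Fin m → ℝ) → (Fin 2 → Finset (Fin m))) : Prop :=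
  ∀ val : Fin 2 → Fin m → ℝ, (∀ i g, 0 ≤ val i g) →
    ∀ i : Fin 2, ∀ v' : Fin m → ℝ, (∀ g, 0 ≤ v' g) →
      ∑ g ∈ Mech (Function.update val i v') i, val i g ≤ ∑ g ∈ Mech val i, val i g


/-- Two-agent truthful EF allocation rule seen from the first agent: `g a b` is her bundle. -/
structure GoodRule (m k : ℕ) (g : (Fin m → ℝ) → (Fin m → ℝ) → Finset (Fin m)) : Prop where
  t1 : ∀ a a' b : Fin m → ℝ, (∀ x, 0 ≤ a x) → (∀ x, 0 ≤ a' x) → (∀ x, 0 ≤ b x) →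
    ∑ x ∈ g a' b, a x ≤ ∑ x ∈ g a b, a x
  t2 : ∀ a b b' : Fin m → ℝ, (∀ x, 0 ≤ a x) → (∀ x, 0 ≤ b x) → (∀ x, 0 ≤ b' x) →
    ∑ x ∈ (g a b')ᶜ, b x ≤ ∑ x ∈ (g a b)ᶜ, b x
  e1 : ∀ (T : Finset (Fin m)) (b : Fin m → ℝ), (∀ x, 0 ≤ b x) →
    (T \ g (fun x => if x ∈ T then 1 else 0) b).card ≤
      (T ∩ g (fun x => if x ∈ T then 1 else 0) b).card + k
  e2 : ∀ (T : Finset (Fin m)) (a : Fin m → ℝ), (∀ x, 0 ≤ a x) →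
    (T ∩ g a (fun x => if x ∈ T then 1 else 0)).card ≤
      (T \ g a (fun x => if x ∈ T then 1 else 0)).card + k

theorem GoodRule.swap {m k : ℕ} {g : (Fin m → ℝ) → (Fin m → ℝ) → Finset (Fin m)}
    (h : GoodRule m k g) : GoodRule m k (fun a b => (g b a)ᶜ) where
  t1 := fun a a' b ha ha' hb => h.t2 b a a' hb ha ha'
  t2 := fun a b b' ha hb hb' => by
    simpa using h.t1 b b' a hb hb' ha
  e1 := fun T b hb => by
    have := h.e2 T b hb
    simpa [sdiff_eq_inter_compl] using this
  e2 := fun T a ha => by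
    have := h.e1 T a ha
    simpa [sdiff_eq_inter_compl] using this

/-- The first agent can always secure `S`. -/
def Ctl {m : ℕ} (g : (Fin m → ℝ) → (Fin m → ℝ) → Finset (Fin m)) (S : Finset (Fin m)) : Prop :=
  ∀ b : Fin m → ℝ, (∀ x, 0 ≤ b x) → ∃ a : Fin m → ℝ, (∀ x, 0 ≤ a x) ∧ S ⊆ g a b

theorem desire {m k : ℕ} {g : (Fin m → ℝ) → (Fin m → ℝ) → Finset (Fin m)}
    (h : GoodRule m k g) {S : Finset (Fin m)} {a a0 b : Fin m → ℝ}
    (ha : ∀ x, 0 ≤ a x) (ha0 : ∀ x, 0 ≤ a0 x) (hb : ∀ x, 0 ≤ b x)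
    (hd : ∀ x ∈ S, ∑ z ∈ Sᶜ, a z < a x) (hS : S ⊆ g a0 b) : S ⊆ g a b := by
  intro x hx
  by_contra hxg
  have h1 := h.t1 a a0 b ha ha0 hb
  have h2 : ∑ z ∈ S, a z ≤ ∑ z ∈ g a0 b, a z :=
    sum_le_sum_of_subset_of_nonneg hS (fun z _ _ => ha z)
  have h3 : ∑ z ∈ g a b, a z ≤ ∑ z ∈ univ.erase x, a z :=
    sum_le_sum_of_subset_of_nonneg (fun z hz => by
      simp only [mem_erase, mem_univ, and_true]
      rintro rfl; exact hxg hz) (fun z _ _ => ha z)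
  have h4 : ∑ z ∈ univ.erase x, a z + a x = ∑ z, a z := sum_erase_add _ _ (mem_univ x)
  have h5 : ∑ z ∈ S, a z + ∑ z ∈ Sᶜ, a z = ∑ z, a z := sum_add_sum_compl S a
  have := hd x hx
  linarith

theorem ctl_step {m k : ℕ} {g : (Fin m → ℝ) → (Fin m → ℝ) → Finset (Fin m)}
    (h : GoodRule m k g) {S : Finset (Fin m)} {j : Fin m} (hj : j ∉ S)
    {a0 b0 : Fin m → ℝ} (ha0 : ∀ x, 0 ≤ a0 x) (hb0 : ∀ x, 0 < b0 x)
    (hS : Ctl g S) (hcj : Ctl g {j}) (hoff : insert j S ⊆ g a0 b0) :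
    Ctl g (insert j S) := by
  intro b1 hb1
  by_contra hcon
  push Not at hcon
  set A : Fin m → ℝ := fun z => if z = j then (m : ℝ) + 1 else if z ∈ S then 1 else 0 with hA
  set A' : Fin m → ℝ := fun z => if z ∈ S then 2 else if z = j then 1 else 0 with hA'
  have hm0 : (0 : ℝ) ≤ m := Nat.cast_nonneg m
  have hAn : ∀ x, 0 ≤ A x := by intro x; simp only [hA]; split_ifs <;> linarith
  have hAn' : ∀ x, 0 ≤ A' x := by intro x; simp only [hA']; split_ifs <;> norm_num
  have hb0' : ∀ x, 0 ≤ b0 x := fun x => (hb0 x).le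
  -- desires
  have dA : ∀ x ∈ insert j S, ∑ z ∈ (insert j S)ᶜ, A z < A x := by
    intro x hx
    have : ∑ z ∈ (insert j S)ᶜ, A z = 0 := by
      apply sum_eq_zero
      intro z hz
      simp only [mem_compl, mem_insert, not_or] at hz
      simp [hA, hz.1, hz.2]
    rw [this]
    simp only [mem_insert] at hx
    simp only [hA]
    split_ifs with h1 h2
    · linarith
    · norm_num
    · tauto
  have dA' : ∀ x ∈ insert j S, ∑ z ∈ (insert j S)ᶜ, A' z < A' x := by
    intro x hx
    have : ∑ z ∈ (insert j S)ᶜ, A' z = 0 := by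
      apply sum_eq_zero
      intro z hz
      simp only [mem_compl, mem_insert, not_or] at hz
      simp [hA', hz.1, hz.2]
    rw [this]
    simp only [mem_insert] at hx
    simp only [hA']
    split_ifs with h1 h2
    · norm_num
    · norm_num
    · tauto
  have dj : ∀ x ∈ ({j} : Finset (Fin m)), ∑ z ∈ ({j} : Finset (Fin m))ᶜ, A z < A x := by
    intro x hx
    rw [mem_singleton] at hx
    subst hx
    have h1 : ∑ z ∈ ({x} : Finset (Fin m))ᶜ, A z ≤ ∑ z ∈ ({x} : Finset (Fin m))ᶜ, (1 : ℝ) := by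
      apply sum_le_sum
      intro z hz
      simp only [mem_compl, mem_singleton] at hz
      simp only [hA, if_neg hz]
      split_ifs <;> norm_num
    have h2 : ∑ z ∈ ({x} : Finset (Fin m))ᶜ, (1 : ℝ) ≤ m := by
      rw [sum_const, nsmul_eq_mul, mul_one]
      exact_mod_cast (card_le_univ _).trans (by simp)
    have h3 : A x = m + 1 := by simp [hA]
    linarith
  have dS : ∀ x ∈ S, ∑ z ∈ Sᶜ, A' z < A' x := by
    intro x hx
    have h1 : ∑ z ∈ Sᶜ, A' z = 1 := by
      rw [sum_eq_single_of_mem j (by simpa using hj)]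
      · simp [hA', hj]
      · intro z hz hzj
        simp only [mem_compl] at hz
        simp [hA', hz, hzj]
    rw [h1]
    simp [hA', hx]
  obtain ⟨x, hx, hxg⟩ := not_subset.1 (hcon A hAn)
  have hxS : x ∈ S := by
    rcases mem_insert.1 hx with rfl | hx
    · exfalso
      obtain ⟨a, ha, hs⟩ := hcj b1 hb1
      exact hxg (desire h hAn ha hb1 dj hs (mem_singleton_self _))
    · exact hx
  set Y := (g A' b0)ᶜ with hY
  have hoff' : insert j S ⊆ g A' b0 := desire h hAn' ha0 hb0' dA' hoff
  have hxY : x ∉ Y := by simp only [hY, mem_compl, not_not]; exact hoff' hx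
  set N : ℝ := ∑ z, b0 z + m + 1 with hN
  have hsum0 : 0 ≤ ∑ z, b0 z := sum_nonneg (fun z _ => hb0' z)
  set b2 : Fin m → ℝ := fun z => b0 z + (if z ∈ Y then 1 else 0) + (if z = x then N else 0)
    with hb2
  have hb2n : ∀ z, 0 ≤ b2 z := by
    intro z
    have := hb0' z
    simp only [hb2]
    split_ifs <;> linarith
  -- sums of `b2` over sets avoiding `x`
  have hform : ∀ Z : Finset (Fin m), x ∉ Z →
      ∑ z ∈ Z, b2 z = ∑ z ∈ Z, b0 z + ((Z ∩ Y).card : ℝ) := by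
    intro Z hZ
    have : ∀ z ∈ Z, b2 z = b0 z + (if z ∈ Y then 1 else 0) := by
      intro z hz
      have : z ≠ x := by rintro rfl; exact hZ hz
      simp [hb2, this]
    rw [sum_congr rfl this, sum_add_distrib]
    congr 1
    rw [← sum_filter, sum_const, nsmul_eq_mul, mul_one, filter_mem_eq_inter]
  have c1 : x ∉ g A b2 := by
    intro hxin
    have h1 := h.t2 A b2 b1 hAn hb2n hb1
    have h2 : b2 x ≤ ∑ z ∈ (g A b1)ᶜ, b2 z :=
      single_le_sum (f := b2) (fun z _ => hb2n z) (by simpa using hxg)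
    have h3 := hform (g A b2)ᶜ (by simpa using hxin)
    have h4 : ∑ z ∈ (g A b2)ᶜ, b0 z ≤ ∑ z, b0 z :=
      sum_le_sum_of_subset_of_nonneg (subset_univ _) (fun z _ _ => hb0' z)
    have h5 : ((((g A b2)ᶜ) ∩ Y).card : ℝ) ≤ m := by
      exact_mod_cast (card_le_univ _).trans (by simp)
    have h6 : b2 x = b0 x + N := by simp [hb2, hxY]
    have := hb0 x
    linarith
  have hSg : S ⊆ g A' b2 := by
    obtain ⟨a, ha, hs⟩ := hS b2 hb2n
    exact desire h hAn' ha hb2n dS hs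
  set Z := (g A' b2)ᶜ with hZ
  have hxZ : x ∉ Z := by simp only [hZ, mem_compl, not_not]; exact hSg hxS
  have i1 : ∑ z ∈ Y, b2 z ≤ ∑ z ∈ Z, b2 z := h.t2 A' b2 b0 hAn' hb2n hb0'
  have i2 : ∑ z ∈ Z, b0 z ≤ ∑ z ∈ Y, b0 z := h.t2 A' b0 b2 hAn' hb0' hb2n
  rw [hform Y hxY, hform Z hxZ, inter_self] at i1
  have i3 : Y.card ≤ (Z ∩ Y).card := by
    have : (Y.card : ℝ) ≤ (Z ∩ Y).card := by linarith
    exact_mod_cast this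
  have i4 : Z ∩ Y = Y := eq_of_subset_of_card_le inter_subset_right i3
  have i5 : Y ⊆ Z := inter_eq_right.1 i4
  have i6 : Z ⊆ Y := by
    intro z hz
    by_contra hzY
    have := sum_lt_sum_of_subset (f := b0) i5 hz hzY (hb0 z) (fun w _ _ => hb0' w)
    linarith
  have i7 : insert j S ⊆ g A' b2 := by
    intro y hy
    have hyY : y ∉ Y := by simp only [hY, mem_compl, not_not]; exact hoff' hy
    by_contra hyg
    exact hyY (i6 (by simpa [hZ] using hyg))
  exact c1 (desire h hAn hAn' hb2n dA i7 hx)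

theorem ctl_set {m k : ℕ} {g : (Fin m → ℝ) → (Fin m → ℝ) → Finset (Fin m)}
    (h : GoodRule m k g) {a0 b0 : Fin m → ℝ} (ha0 : ∀ x, 0 ≤ a0 x) (hb0 : ∀ x, 0 < b0 x)
    (S : Finset (Fin m)) (hc : ∀ j ∈ S, Ctl g {j}) (hoff : S ⊆ g a0 b0) : Ctl g S := by
  induction S using Finset.induction_on with
  | empty => intro b _; exact ⟨fun _ => 0, fun _ => le_rfl, empty_subset _⟩
  | insert j S hj ih =>
    exact ctl_step h hj ha0 hb0
      (ih (fun i hi => hc i (mem_insert_of_mem hi)) ((subset_insert _ _).trans hoff))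
      (hc j (mem_insert_self _ _)) hoff

theorem ctl_small {m k : ℕ} {g : (Fin m → ℝ) → (Fin m → ℝ) → Finset (Fin m)}
    (h : GoodRule m k g) (S : Finset (Fin m)) (hS : Ctl g S) : S.card ≤ k := by
  obtain ⟨a, ha, hs⟩ := hS (fun x => if x ∈ S then 1 else 0)
    (fun x => by split_ifs <;> norm_num)
  have := h.e2 S a ha
  rw [inter_eq_left.2 hs, sdiff_eq_empty_iff_subset.2 hs] at this
  simpa using this

theorem ctl_singles {m k : ℕ} {g : (Fin m → ℝ) → (Fin m → ℝ) → Finset (Fin m)}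
    (h : GoodRule m k g) (T : Finset (Fin m)) (hT : ∀ j ∈ T, Ctl g {j}) : T.card ≤ 3 * k := by
  set a : Fin m → ℝ := fun x => if x ∈ T then 1 else 0 with ha
  have han : ∀ x, 0 ≤ a x := by intro x; simp only [ha]; split_ifs <;> norm_num
  have h1 := h.e1 T (fun _ => 1) (fun _ => zero_le_one)
  rw [← ha] at h1
  have h2 := ctl_small h (T ∩ g a (fun _ => 1)) (ctl_set h (b0 := fun _ => 1) han
    (fun _ => one_pos) _ (fun j hj => hT j (mem_inter.1 hj).1) inter_subset_right)
  have h3 := card_sdiff_add_card_inter T (g a (fun _ => 1))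
  omega

theorem ctl_single_of_mem {m k : ℕ} {g : (Fin m → ℝ) → (Fin m → ℝ) → Finset (Fin m)}
    (h : GoodRule m k g) (j : Fin m) (e : Fin m → ℝ) (he : e = fun x => if x = j then 1 else 0)
    (hj : j ∈ g e e) : Ctl g {j} := by
  have hen : ∀ x, 0 ≤ e x := by intro x; simp only [he]; split_ifs <;> norm_num
  intro b hb
  refine ⟨e, hen, ?_⟩
  rw [singleton_subset_iff]
  by_contra hjn
  have h1 := h.t2 e e b hen hen hb
  have h2 : e j ≤ ∑ z ∈ (g e b)ᶜ, e z :=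
    single_le_sum (f := e) (fun z _ => hen z) (by simpa using hjn)
  have h3 : ∑ z ∈ (g e e)ᶜ, e z = 0 := by
    apply sum_eq_zero
    intro z hz
    have : z ≠ j := by rintro rfl; simp at hz; exact hz hj
    simp [he, this]
  have h4 : e j = 1 := by simp [he]
  linarith

theorem good_bound {m k : ℕ} {g : (Fin m → ℝ) → (Fin m → ℝ) → Finset (Fin m)}
    (h : GoodRule m k g) : m ≤ 6 * k := by
  classical
  set e : Fin m → Fin m → ℝ := fun j x => if x = j then 1 else 0 with he
  set T := univ.filter (fun j => j ∈ g (e j) (e j)) with hT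
  have h1 := ctl_singles h T (fun j hj => ctl_single_of_mem h j (e j) rfl (by simpa [hT] using hj))
  have h2 := ctl_singles h.swap Tᶜ
    (fun j hj => ctl_single_of_mem h.swap j (e j) rfl (by simpa [hT] using hj))
  have h3 := card_add_card_compl T
  simp only [Fintype.card_fin] at h3
  omega

/-- EF for an indicator valuation, in terms of cardinalities. -/
theorem ef_card {m : ℕ} {u w : ℕ} (T A B Si Sj : Finset (Fin m)) (v : Fin m → ℝ)
    (hv : v = fun x => if x ∈ T then 1 else 0) (hSi : Si.card ≤ u) (hSj : Sj.card ≤ w)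
    (hle : ∑ x ∈ B \ Sj, v x ≤ ∑ x ∈ A ∪ Si, v x) :
    (T ∩ B).card ≤ (T ∩ A).card + (u + w) := by
  have hs : ∀ Z : Finset (Fin m), ∑ x ∈ Z, v x = ((Z ∩ T).card : ℝ) := by
    intro Z
    rw [hv, ← sum_filter, sum_const, nsmul_eq_mul, mul_one, filter_mem_eq_inter]
  rw [hs, hs, Nat.cast_le] at hle
  have h1 : ((A ∪ Si) ∩ T).card ≤ (T ∩ A).card + Si.card := by
    refine (card_le_card ?_).trans (card_union_le (T ∩ A) Si)
    intro z; simp only [mem_inter, mem_union]; tauto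
  have h2 : (T ∩ B).card ≤ ((B \ Sj) ∩ T).card + Sj.card := by
    refine (card_le_card ?_).trans (card_union_le _ Sj)
    intro z; simp only [mem_inter, mem_union, mem_sdiff]; tauto
  omega

/-- For all `u, v` and any `m ≥ 6u + 6v + 2` items, there is no deterministic truthful
mechanism for two agents with additive valuations that always outputs an EF^{+u}_{-v}
allocation. -/
theorem no_truthful_EFpm_deterministic_two_agents (u w m : ℕ)
    (hm : 6 * u + 6 * w + 2 ≤ m) :
    ¬ ∃ Mech : (Fin 2 → Fin m → ℝ) → (Fin 2 → Finset (Fin m)),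
        (∀ val, (∀ i g, 0 ≤ val i g) → IsPartition Finset.univ (Mech val)) ∧
        (∀ val, (∀ i g, 0 ≤ val i g) → EFpm Finset.univ val (Mech val) u w) ∧
        Truthful2 Mech := by
  rintro ⟨Mech, hP, hE, hT⟩
  have nn : ∀ a b : Fin m → ℝ, (∀ x, 0 ≤ a x) → (∀ x, 0 ≤ b x) →
      ∀ i g, 0 ≤ (![a, b] : Fin 2 → Fin m → ℝ) i g := by
    intro a b ha hb i g
    fin_cases i
    · exact ha g
    · exact hb g
  have hc : ∀ a b : Fin m → ℝ, (∀ x, 0 ≤ a x) → (∀ x, 0 ≤ b x) →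
      (Mech ![a, b] 0)ᶜ = Mech ![a, b] 1 := by
    intro a b ha hb
    obtain ⟨-, h2, h3⟩ := hP _ (nn a b ha hb)
    ext z
    rw [mem_compl]
    constructor
    · intro hz
      obtain ⟨i, hi⟩ := h3 z (mem_univ z)
      fin_cases i
      · exact absurd hi hz
      · exact hi
    · intro hz hz0
      exact disjoint_left.1 (h2 0 1 (by decide)) hz0 hz
  have u0 : ∀ a b a' : Fin m → ℝ,
      Function.update (![a, b] : Fin 2 → Fin m → ℝ) 0 a' = ![a', b] := by
    intro a b a'; ext i; fin_cases i <;> simp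
  have u1 : ∀ a b b' : Fin m → ℝ,
      Function.update (![a, b] : Fin 2 → Fin m → ℝ) 1 b' = ![a, b'] := by
    intro a b a'; ext i; fin_cases i <;> simp
  have ind : ∀ T : Finset (Fin m), ∀ x, (0 : ℝ) ≤ if x ∈ T then 1 else 0 := by
    intro T x; split_ifs <;> norm_num
  have good : GoodRule m (u + w) (fun a b => Mech ![a, b] 0) := by
    refine ⟨?_, ?_, ?_, ?_⟩
    · intro a a' b ha ha' hb
      have := hT ![a, b] (nn a b ha hb) 0 a' ha'
      rw [u0] at this
      simpa using this
    · intro a b b' ha hb hb'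
      have := hT ![a, b] (nn a b ha hb) 1 b' hb'
      rw [u1] at this
      simp only [hc a b ha hb, hc a b' ha hb']
      simpa using this
    · intro T b hb
      obtain ⟨Si, Sj, -, -, h1, -, h2, h3⟩ := hE _ (nn _ b (ind T) hb) 0 1
      have := ef_card T _ _ Si Sj _ rfl h1 h2 h3
      rw [sdiff_eq_inter_compl, hc _ b (ind T) hb]
      exact this
    · intro T a ha
      obtain ⟨Si, Sj, -, -, h1, -, h2, h3⟩ := hE _ (nn a _ ha (ind T)) 1 0
      have := ef_card T _ _ Si Sj _ rfl h1 h2 h3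
      rw [sdiff_eq_inter_compl, hc a _ ha (ind T)]
      exact this
  have := good_bound good
  omega
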